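/- arXiv:2604.04646 — 5 statements merged into one kernel-verified Lean document; each statement's English description precedes it below -/
import Mathlib

section
/- Suppose α̇·β − α·β̇ ≠ 0. Then the marginal velocity u is differentiable on ℝ^d, and for every x ∈ ℝ^d the posterior mean-squared discrepancy between the marginal velocity and the sample-wise velocities satisfies (1/p(x)) · ∫ ‖u(x) − v(x, y)‖² · g(x, y) dμ(y) = ((α̇·β − α·β̇)/α) · (β · div u(x) − β̇ · d), where div u(x) denotes the divergence of u at x, i.e. the trace of the Fréchet derivative of u at x. -/
open MeasureTheory

lemma aux_integrable {E G : Type*} [NormedAddCommGroup E] [MeasurableSpace E]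
    [BorelSpace E] [SecondCountableTopology E]
    [NormedAddCommGroup G] 
    (μ : Measure E) [IsProbabilityMeasure μ] (K : Set E) (hK : IsCompact K) (hμK : μ Kᶜ = 0)
    (f : E → G) (hf : Continuous f) : Integrable f μ := by
  obtain ⟨C, hC⟩ := hK.exists_bound_of_continuousOn hf.continuousOn
  have hae : ∀ᵐ y ∂μ, y ∈ K := hμK
  exact Integrable.of_bound hf.aestronglyMeasurable C (hae.mono hC)

lemma aux_deriv {E G : Type*} [NormedAddCommGroup E] [NormedSpace ℝ E] [MeasurableSpace E]
    [BorelSpace E] [ProperSpace E]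
    [NormedAddCommGroup G] [NormedSpace ℝ G]
    (μ : Measure E) [IsProbabilityMeasure μ] (K : Set E) (hK : IsCompact K) (hμK : μ Kᶜ = 0)
    (F : E → E → G) (F' : E → E → E →L[ℝ] G)
    (hF : Continuous (Function.uncurry F))
    (hF' : Continuous (Function.uncurry F'))
    (h : ∀ x y, HasFDerivAt (fun x => F x y) (F' x y) x) (x : E) :
    HasFDerivAt (fun x => ∫ y, F x y ∂μ) (∫ y, F' x y ∂μ) x := by
  obtain ⟨C, hC⟩ := ((isCompact_closedBall x 1).prod hK).exists_bound_of_continuousOn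
    hF'.continuousOn
  have hae : ∀ᵐ y ∂μ, y ∈ K := hμK
  have c1 : ∀ z, Continuous (F z) := fun z => hF.comp (by fun_prop : Continuous fun y => (z, y))
  have c2 : ∀ z, Continuous (F' z) := fun z => hF'.comp (by fun_prop : Continuous fun y => (z, y))
  refine hasFDerivAt_integral_of_dominated_of_fderiv_le (bound := fun _ => C)
    (Metric.ball_mem_nhds x one_pos)
    (Filter.Eventually.of_forall fun z => (c1 z).aestronglyMeasurable)
    (aux_integrable μ K hK hμK _ (c1 x)) (c2 x).aestronglyMeasurable ?_ (integrable_const _)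
    (Filter.Eventually.of_forall fun y z _ => h z y)
  filter_upwards [hae] with y hy z hz
  exact hC (z, y) ⟨Metric.ball_subset_closedBall hz, hy⟩

/-- Suppose α̇·β − α·β̇ ≠ 0. Then the marginal velocity `u` is
differentiable on ℝ^d, and for every `x` the posterior mean-squared discrepancy between
the marginal velocity and the sample-wise velocities satisfies
`(1/p x) * ∫ ‖u x − v x y‖² g x y dμ = ((α̇β − αβ̇)/α) (β · div u x − β̇ · d)`,
where `div u x` is the trace of the Fréchet derivative of `u` at `x`. -/
theorem stmt_0
    (d : ℕ) (hd : 1 ≤ d)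
    (α β αdot βdot : ℝ) (hα : 0 < α) (hβ : 0 < β)
    (μ : Measure (EuclideanSpace ℝ (Fin d))) [IsProbabilityMeasure μ]
    (K : Set (EuclideanSpace ℝ (Fin d))) (hK : IsCompact K) (hμK : μ Kᶜ = 0)
    (g : EuclideanSpace ℝ (Fin d) → EuclideanSpace ℝ (Fin d) → ℝ)
    (hg : ∀ x y, g x y =
      (2 * Real.pi * β ^ 2) ^ (-(d : ℝ) / 2) * Real.exp (-‖x - α • y‖ ^ 2 / (2 * β ^ 2)))
    (p : EuclideanSpace ℝ (Fin d) → ℝ)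
    (hp : ∀ x, p x = ∫ y, g x y ∂μ)
    (hppos : ∀ x, 0 < p x)
    (v : EuclideanSpace ℝ (Fin d) → EuclideanSpace ℝ (Fin d) → EuclideanSpace ℝ (Fin d))
    (hv : ∀ x y, v x y = αdot • y + (βdot / β) • (x - α • y))
    (u : EuclideanSpace ℝ (Fin d) → EuclideanSpace ℝ (Fin d))
    (hu : ∀ x, u x = (p x)⁻¹ • ∫ y, g x y • v x y ∂μ)
    (hne : αdot * β - α * βdot ≠ 0) :
    Differentiable ℝ u ∧
      ∀ x, (p x)⁻¹ * ∫ y, ‖u x - v x y‖ ^ 2 * g x y ∂μ =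
        ((αdot * β - α * βdot) / α) *
          (β * LinearMap.trace ℝ (EuclideanSpace ℝ (Fin d)) (fderiv ℝ u x).toLinearMap
            - βdot * (d : ℝ)) := by
  have hae : ∀ᵐ y ∂μ, y ∈ K := hμK
  set g' : EuclideanSpace ℝ (Fin d) → EuclideanSpace ℝ (Fin d) →
    EuclideanSpace ℝ (Fin d) →L[ℝ] ℝ :=
    fun x y => (-(g x y) / β ^ 2) • innerSL ℝ (x - α • y) with hg'
  have hgc : Continuous (Function.uncurry g) := by
    have : Function.uncurry g = fun q => (2 * Real.pi * β ^ 2) ^ (-(d : ℝ) / 2) *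
      Real.exp (-‖q.1 - α • q.2‖ ^ 2 / (2 * β ^ 2)) := by
      ext q; exact hg _ _
    rw [this]; fun_prop
  have hgc' : Continuous fun q : EuclideanSpace ℝ (Fin d) × EuclideanSpace ℝ (Fin d) =>
    g q.1 q.2 := hgc
  have hgcx : ∀ x, Continuous (g x) := fun z =>
    hgc.comp (by fun_prop : Continuous fun y => (z, y))
  have hg'c : Continuous (Function.uncurry g') := by
    change Continuous fun q : EuclideanSpace ℝ (Fin d) × EuclideanSpace ℝ (Fin d) =>
      (-(g q.1 q.2) / β ^ 2) • innerSL ℝ (q.1 - α • q.2)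
    exact (hgc'.neg.div_const _).smul ((innerSL ℝ).continuous.comp (by fun_prop))
  have hgd : ∀ x y, HasFDerivAt (fun x => g x y) (g' x y) x := by
    intro x y
    have e : (fun x => g x y) = fun x => (2 * Real.pi * β ^ 2) ^ (-(d : ℝ) / 2) *
      Real.exp (-‖x - α • y‖ ^ 2 / (2 * β ^ 2)) := by
      ext q; exact hg _ _
    rw [e]
    have h1 : HasFDerivAt (fun x : EuclideanSpace ℝ (Fin d) => x - α • y)
      (ContinuousLinearMap.id ℝ _) x := (hasFDerivAt_id x).sub_const _
    have h2 := ((((h1.norm_sq).neg).mul_const (2 * β ^ 2)⁻¹).exp).const_mul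
      ((2 * Real.pi * β ^ 2) ^ (-(d : ℝ) / 2))
    simp only [← div_eq_mul_inv] at h2
    refine h2.congr_fderiv ?_
    ext z
    simp [hg', hg]
    field_simp
  have ig : ∀ x, Integrable (g x) μ := fun x => aux_integrable μ K hK hμK _ (hgcx x)
  have igy : ∀ x, Integrable (fun y => g x y • y) μ := fun x =>
    aux_integrable μ K hK hμK _ ((hgcx x).smul continuous_id)
  have igyy : ∀ x, Integrable (fun y => g x y * inner ℝ y y) μ := fun x =>
    aux_integrable μ K hK hμK _ ((hgcx x).mul (by fun_prop))
  have hg'cx : ∀ x, Continuous (g' x) := fun z =>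
    hg'c.comp (by fun_prop : Continuous fun y => (z, y))
  have ig' : ∀ x, Integrable (g' x) μ := fun x => aux_integrable μ K hK hμK _ (hg'cx x)
  have cN' : Continuous (Function.uncurry fun x y => (g' x y).smulRight y) := by
    have := hg'c
    change Continuous fun q : EuclideanSpace ℝ (Fin d) × EuclideanSpace ℝ (Fin d) =>
      ContinuousLinearMap.smulRightL ℝ _ _ (Function.uncurry g' q) q.2
    fun_prop
  have iN' : ∀ x, Integrable (fun y => (g' x y).smulRight y) μ := fun x =>
    aux_integrable μ K hK hμK _ (cN'.comp (by fun_prop : Continuous fun y => (x, y)))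
  have dp : ∀ x, HasFDerivAt p (∫ y, g' x y ∂μ) x := by
    intro x
    rw [funext hp]
    exact aux_deriv μ K hK hμK g g' hgc hg'c hgd x
  set N : EuclideanSpace ℝ (Fin d) → EuclideanSpace ℝ (Fin d) := fun x => ∫ y, g x y • y ∂μ
    with hN
  have dN : ∀ x, HasFDerivAt N (∫ y, (g' x y).smulRight y ∂μ) x :=
    aux_deriv μ K hK hμK (fun x y => g x y • y) (fun x y => (g' x y).smulRight y)
      (hgc.smul continuous_snd) cN' (fun x y => (hgd x y).smul_const y)
  set c := αdot - βdot / β * α with hc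
  have hu' : u = fun x => (βdot / β) • x + c • ((p x)⁻¹ • N x) := by
    ext1 x
    rw [hu]
    have : ∀ y, g x y • v x y = g x y • ((βdot / β) • x) + c • (g x y • y) := by
      intro y; rw [hv, hc]; module
    simp_rw [this]
    have i2 : Integrable (fun y => c • (g x y • y)) μ := (igy x).smul c
    rw [integral_add ((ig x).smul_const _) i2, integral_smul_const, ← hp,
      integral_smul, smul_add, smul_smul, inv_mul_cancel₀ (hppos x).ne', one_smul,
      smul_comm c]
  have du : ∀ x, HasFDerivAt u ((βdot / β) • ContinuousLinearMap.id ℝ _ +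
      c • ((p x)⁻¹ • (∫ y, (g' x y).smulRight y ∂μ) +
        ((-(p x ^ 2)⁻¹) • (∫ y, g' x y ∂μ)).smulRight (N x))) x := by
    intro x
    rw [hu']
    have hi : HasFDerivAt (fun x => (p x)⁻¹) ((-(p x ^ 2)⁻¹) • (∫ y, g' x y ∂μ)) x :=
      (hasDerivAt_inv (hppos x).ne').comp_hasFDerivAt x (dp x)
    exact ((hasFDerivAt_id x).const_smul (βdot / β)).add ((hi.smul (dN x)).const_smul c)
  refine ⟨fun x => (du x).differentiableAt, fun x => ?_⟩
  rw [(du x).fderiv]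
  set A := ∫ y, g x y * inner ℝ y y ∂μ with hA
  have iin : ∀ w, Integrable (fun y => g x y * inner ℝ w y) μ := fun w =>
    aux_integrable μ K hK hμK _ ((hgcx x).mul (by fun_prop))
  have hin : ∀ w, ∫ y, g x y * inner ℝ w y ∂μ = inner ℝ w (N x) := by
    intro w
    rw [hN, ← integral_inner (igy x)]
    simp [inner_smul_right]
  have hP' : (∫ y, g' x y ∂μ) (N x) =
      -(p x * inner ℝ x (N x) - α * inner ℝ (N x) (N x)) / β ^ 2 := by
    rw [ContinuousLinearMap.integral_apply (ig' x)]
    have : ∀ y, g' x y (N x) =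
        (-(inner ℝ x (N x)) / β ^ 2) * g x y + (α / β ^ 2) * (g x y * inner ℝ (N x) y) := by
      intro y
      simp only [hg', smul_apply, innerSL_apply_apply, smul_eq_mul,
        inner_sub_left, inner_smul_left, real_inner_comm y (N x)]
      simp
      ring
    simp_rw [this]
    rw [integral_add ((ig x).const_mul _) ((iin _).const_mul _), integral_const_mul,
      integral_const_mul, hin, ← hp]
    ring
  have hD : LinearMap.trace ℝ (EuclideanSpace ℝ (Fin d))
      (∫ y, (g' x y).smulRight y ∂μ).toLinearMap = -(inner ℝ x (N x) - α * A) / β ^ 2 := by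
    let L : (EuclideanSpace ℝ (Fin d) →L[ℝ] EuclideanSpace ℝ (Fin d)) →L[ℝ] ℝ :=
      LinearMap.toContinuousLinearMap
        ((LinearMap.trace ℝ (EuclideanSpace ℝ (Fin d))) ∘ₗ ContinuousLinearMap.coeLM ℝ)
    have h1 := L.integral_comp_comm (iN' x)
    change _ = LinearMap.trace ℝ (EuclideanSpace ℝ (Fin d))
      (∫ y, (g' x y).smulRight y ∂μ).toLinearMap at h1
    rw [← h1]
    have : ∀ y, L ((g' x y).smulRight y) =
        (-1 / β ^ 2) * (g x y * inner ℝ x y) + (α / β ^ 2) * (g x y * inner ℝ y y) := by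
      intro y
      change LinearMap.trace ℝ (EuclideanSpace ℝ (Fin d))
        ((g' x y).toLinearMap.smulRight y) = _
      rw [LinearMap.trace_smulRight]
      simp only [hg', ContinuousLinearMap.coe_coe, smul_apply,
        innerSL_apply_apply, smul_eq_mul, inner_sub_left, inner_smul_left]
      simp
      ring
    simp_rw [this]
    rw [integral_add ((iin _).const_mul _) ((igyy x).const_mul _), integral_const_mul,
      integral_const_mul, hin]
    ring
  have hP2 : LinearMap.trace ℝ (EuclideanSpace ℝ (Fin d))
      (((-(p x ^ 2)⁻¹) • (∫ y, g' x y ∂μ)).smulRight (N x)).toLinearMap =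
      (-(p x ^ 2)⁻¹) * (∫ y, g' x y ∂μ) (N x) := by
    change LinearMap.trace ℝ (EuclideanSpace ℝ (Fin d))
        (((-(p x ^ 2)⁻¹) • (∫ y, g' x y ∂μ)).toLinearMap.smulRight (N x)) = _
    rw [LinearMap.trace_smulRight]
    rfl
  have hid : LinearMap.trace ℝ (EuclideanSpace ℝ (Fin d))
      (ContinuousLinearMap.id ℝ (EuclideanSpace ℝ (Fin d))).toLinearMap = d := by
    rw [ContinuousLinearMap.coe_id, LinearMap.trace_id]; simp
  have hL : ∫ y, ‖u x - v x y‖ ^ 2 * g x y ∂μ =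
      c ^ 2 * (A - (p x)⁻¹ * inner ℝ (N x) (N x)) := by
    have : ∀ y, ‖u x - v x y‖ ^ 2 * g x y = (c ^ 2 * (p x)⁻¹ ^ 2 * inner ℝ (N x) (N x)) * g x y
        + (-2 * c ^ 2 * (p x)⁻¹) * (g x y * inner ℝ (N x) y)
        + c ^ 2 * (g x y * inner ℝ y y) := by
      intro y
      have e : u x - v x y = c • ((p x)⁻¹ • N x - y) := by
        rw [hu', hv, hc]; module
      rw [e, norm_smul, mul_pow, norm_sub_sq_real ((p x)⁻¹ • N x) y, norm_smul, mul_pow, inner_smul_left,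
        ← real_inner_self_eq_norm_sq, ← real_inner_self_eq_norm_sq]
      simp
      ring
    simp_rw [this]
    have i2 : Integrable (fun y => (c ^ 2 * (p x)⁻¹ ^ 2 * inner ℝ (N x) (N x)) * g x y
        + (-2 * c ^ 2 * (p x)⁻¹) * (g x y * inner ℝ (N x) y)) μ :=
      ((ig x).const_mul _).add ((iin _).const_mul _)
    rw [integral_add i2 ((igyy x).const_mul _),
      integral_add ((ig x).const_mul _) ((iin _).const_mul _), integral_const_mul,
      integral_const_mul, integral_const_mul, hin, ← hp]
    have := (hppos x).ne'
    field_simp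
    ring
  rw [hL]
  simp only [ContinuousLinearMap.toLinearMap_add, ContinuousLinearMap.toLinearMap_smul, map_add, map_smul, smul_eq_mul]
  rw [hD, hP2, hid, hP', hc]
  have := (hppos x).ne'
  field_simp
  ring
end

section
/- The marginal density p is differentiable on ℝ^d, and for every x ∈ ℝ^d the gradient of the log marginal density equals the posterior average of the conditional score: ∇ log p(x) = (1/p(x)) · ∫ (−(x − α·y)/β²) · g(x, y) dμ(y). -/
open MeasureTheory

/-- The marginal density `p` is differentiable on ℝ^d, and for every `x`
the gradient of the log marginal density equals the posterior average of the conditional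
score: `∇ log p x = (1/p x) • ∫ (−(x − α•y)/β²) · g x y dμ(y)`. -/
theorem stmt_2
    (d : ℕ) (hd : 1 ≤ d)
    (α β : ℝ) (hα : 0 < α) (hβ : 0 < β)
    (μ : Measure (EuclideanSpace ℝ (Fin d))) [IsProbabilityMeasure μ]
    (K : Set (EuclideanSpace ℝ (Fin d))) (hK : IsCompact K) (hμK : μ Kᶜ = 0)
    (g : EuclideanSpace ℝ (Fin d) → EuclideanSpace ℝ (Fin d) → ℝ)
    (hg : ∀ x y, g x y =
      (2 * Real.pi * β ^ 2) ^ (-(d : ℝ) / 2) * Real.exp (-‖x - α • y‖ ^ 2 / (2 * β ^ 2)))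
    (p : EuclideanSpace ℝ (Fin d) → ℝ)
    (hp : ∀ x, p x = ∫ y, g x y ∂μ)
    (hppos : ∀ x, 0 < p x) :
    Differentiable ℝ p ∧
      ∀ x, gradient (fun x => Real.log (p x)) x =
        (p x)⁻¹ • ∫ y, g x y • (-((β ^ 2)⁻¹ • (x - α • y))) ∂μ := by
  set v : EuclideanSpace ℝ (Fin d) → EuclideanSpace ℝ (Fin d) → EuclideanSpace ℝ (Fin d) :=
    fun x y => g x y • (-((β ^ 2)⁻¹ • (x - α • y))) with hv
  have hgc : Continuous (fun z : EuclideanSpace ℝ (Fin d) × EuclideanSpace ℝ (Fin d) =>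
      g z.1 z.2) := by
    simp only [hg]
    fun_prop
  have hvc : Continuous (fun z : EuclideanSpace ℝ (Fin d) × EuclideanSpace ℝ (Fin d) =>
      v z.1 z.2) := by
    simp only [hv]
    exact hgc.smul (by fun_prop)
  have hgy : ∀ x, Continuous (g x) := fun x => hgc.comp (by fun_prop : Continuous fun y => (x, y))
  have hvy : ∀ x, Continuous (v x) := fun x => hvc.comp (by fun_prop : Continuous fun y => (x, y))
  have haeK : ∀ᵐ y ∂μ, y ∈ K := by
    rw [ae_iff]
    exact hμK
  have hgint : ∀ x, Integrable (g x) μ := by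
    intro x
    obtain ⟨C, hC⟩ := hK.exists_bound_of_continuousOn (hgy x).continuousOn
    exact Integrable.of_bound (hgy x).aestronglyMeasurable C (haeK.mono hC)
  have hvint : ∀ x, Integrable (v x) μ := by
    intro x
    obtain ⟨C, hC⟩ := hK.exists_bound_of_continuousOn (hvy x).continuousOn
    exact Integrable.of_bound (hvy x).aestronglyMeasurable C (haeK.mono hC)
  have hgd : ∀ x y, HasFDerivAt (fun x => g x y) (innerSL ℝ (v x y)) x := by
    intro x y
    have h1 : HasFDerivAt (fun x : EuclideanSpace ℝ (Fin d) => x - α • y)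
        (ContinuousLinearMap.id ℝ _) x := (hasFDerivAt_id x).sub_const _
    have h2 := (((h1.norm_sq).neg.mul_const ((2 * β ^ 2)⁻¹)).exp).const_mul
      ((2 * Real.pi * β ^ 2) ^ (-(d : ℝ) / 2))
    have h3 : (fun x => g x y) = fun x => (2 * Real.pi * β ^ 2) ^ (-(d : ℝ) / 2) *
        Real.exp (-‖x - α • y‖ ^ 2 * (2 * β ^ 2)⁻¹) := by
      funext x
      rw [hg, div_eq_mul_inv (-‖x - α • y‖ ^ 2)]
    rw [h3]
    refine h2.congr_fderiv ?_
    ext w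
    simp only [hv, hg, div_eq_mul_inv (-‖x - α • y‖ ^ 2)]
    simp [inner_smul_left]
    field_simp
  have hpd : ∀ x, HasFDerivAt p (innerSL ℝ (∫ y, v x y ∂μ)) x := by
    intro x
    obtain ⟨C, hC⟩ := ((isCompact_closedBall x 1).prod hK).exists_bound_of_continuousOn
      hvc.continuousOn
    have key := hasFDerivAt_integral_of_dominated_of_fderiv_le (μ := μ) (𝕜 := ℝ)
      (F := g) (F' := fun x y => innerSL ℝ (v x y)) (bound := fun _ => C) (x₀ := x)
      (Metric.closedBall_mem_nhds x one_pos)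
      (Filter.Eventually.of_forall fun x => (hgy x).aestronglyMeasurable)
      (hgint x) (((innerSL ℝ).continuous.comp (hvy x)).aestronglyMeasurable)
      (haeK.mono fun y hy z hz => by
        rw [innerSL_apply_norm]
        exact hC (z, y) ⟨hz, hy⟩)
      (integrable_const C)
      (Filter.Eventually.of_forall fun y z _ => hgd z y)
    have hpe : p = fun x => ∫ y, g x y ∂μ := funext hp
    rw [hpe]
    refine key.congr_fderiv ?_
    have hI : Integrable (fun y => innerSL ℝ (v x y)) μ := by
      refine (hvint x).norm.mono' ((innerSL ℝ).continuous.comp (hvy x)).aestronglyMeasurable ?_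
      exact Filter.Eventually.of_forall fun y => (innerSL_apply_norm ℝ (v x y)).le
    ext w
    rw [ContinuousLinearMap.integral_apply hI]
    simp only [innerSL_apply_apply]
    rw [real_inner_comm, ← integral_inner (hvint x)]
    simp only [real_inner_comm]
  refine ⟨fun x => (hpd x).differentiableAt, fun x => ?_⟩
  apply HasGradientAt.gradient
  rw [hasGradientAt_iff_hasFDerivAt]
  refine ((hpd x).log (hppos x).ne').congr_fderiv ?_
  change _ = InnerProductSpace.toDual ℝ _ ((p x)⁻¹ • ∫ y, v x y ∂μ)
  ext w
  simp
end

section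
/- Set b = α̇ − α·β̇/β and suppose b ≠ 0. Then for every x, y ∈ ℝ^d, the gradient in x of the log posterior density satisfies ∇ₓ log(g(x, y)/p(x)) = (α/(β²·b)) · (v(x, y) − u(x)). -/
open MeasureTheory

/-- Set `b = α̇ − α·β̇/β` and suppose `b ≠ 0`. Then for every `x, y`,
the gradient in `x` of the log posterior density satisfies
`∇ₓ log (g x y / p x) = (α/(β²·b)) • (v x y − u x)`. -/
theorem stmt_6
    (d : ℕ) (hd : 1 ≤ d)
    (α β αdot βdot : ℝ) (hα : 0 < α) (hβ : 0 < β)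
    (μ : Measure (EuclideanSpace ℝ (Fin d))) [IsProbabilityMeasure μ]
    (K : Set (EuclideanSpace ℝ (Fin d))) (hK : IsCompact K) (hμK : μ Kᶜ = 0)
    (g : EuclideanSpace ℝ (Fin d) → EuclideanSpace ℝ (Fin d) → ℝ)
    (hg : ∀ x y, g x y =
      (2 * Real.pi * β ^ 2) ^ (-(d : ℝ) / 2) * Real.exp (-‖x - α • y‖ ^ 2 / (2 * β ^ 2)))
    (p : EuclideanSpace ℝ (Fin d) → ℝ)
    (hp : ∀ x, p x = ∫ y, g x y ∂μ)
    (hppos : ∀ x, 0 < p x)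
    (v : EuclideanSpace ℝ (Fin d) → EuclideanSpace ℝ (Fin d) → EuclideanSpace ℝ (Fin d))
    (hv : ∀ x y, v x y = αdot • y + (βdot / β) • (x - α • y))
    (u : EuclideanSpace ℝ (Fin d) → EuclideanSpace ℝ (Fin d))
    (hu : ∀ x, u x = (p x)⁻¹ • ∫ y, g x y • v x y ∂μ)
    (b : ℝ) (hb : b = αdot - α * βdot / β) (hbne : b ≠ 0) :
    ∀ x y, gradient (fun x => Real.log (g x y / p x)) x =
      (α / (β ^ 2 * b)) • (v x y - u x) := by
  intro x y
  have hgpos : ∀ x y, 0 < g x y := by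
    intro x y
    rw [hg]
    positivity
  let G : EuclideanSpace ℝ (Fin d) → EuclideanSpace ℝ (Fin d) → EuclideanSpace ℝ (Fin d) := fun x y => g x y • (-(β ^ 2)⁻¹ • (x - α • y))
  have hgc : Continuous (fun q : EuclideanSpace ℝ (Fin d) × EuclideanSpace ℝ (Fin d) => g q.1 q.2) := by
    simp only [hg]
    fun_prop
  have hGc : Continuous (fun q : EuclideanSpace ℝ (Fin d) × EuclideanSpace ℝ (Fin d) => G q.1 q.2) := by
    simp only [G]
    fun_prop
  have hgd : ∀ x y, HasFDerivAt (fun x => g x y) (innerSL ℝ (G x y)) x := by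
    intro x y
    have h1 : HasFDerivAt (fun x : EuclideanSpace ℝ (Fin d) => x - α • y) (ContinuousLinearMap.id ℝ (EuclideanSpace ℝ (Fin d))) x :=
      (hasFDerivAt_id x).sub_const _
    have h2 := ((h1.norm_sq.const_mul (-(2 * β ^ 2)⁻¹)).exp).const_mul
      ((2 * Real.pi * β ^ 2) ^ (-(d : ℝ) / 2))
    have h3 : (fun x => g x y) = fun x => (2 * Real.pi * β ^ 2) ^ (-(d : ℝ) / 2) *
        Real.exp (-(2 * β ^ 2)⁻¹ * ‖x - α • y‖ ^ 2) := by
      funext x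
      rw [hg]
      congr 2
      ring
    rw [h3]
    refine h2.congr_fderiv ?_
    ext z
    have h4 := congrFun h3 x
    simp only [G, h4, map_smul, ContinuousLinearMap.smul_apply, innerSL_apply_apply, smul_eq_mul,
      ContinuousLinearMap.comp_apply, ContinuousLinearMap.id_apply, nsmul_eq_mul]
    simp
    field_simp
  have hKae : ∀ᵐ a ∂μ, a ∈ K := by
    rw [ae_iff]
    exact hμK
  have hint : ∀ (f : EuclideanSpace ℝ (Fin d) → EuclideanSpace ℝ (Fin d)), Continuous f → Integrable f μ := by
    intro f hf
    obtain ⟨C, hC⟩ := hK.exists_bound_of_continuousOn hf.continuousOn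
    exact Integrable.of_bound hf.aestronglyMeasurable C (hKae.mono fun a ha => hC a ha)
  have hintR : ∀ (f : EuclideanSpace ℝ (Fin d) → ℝ), Continuous f → Integrable f μ := by
    intro f hf
    obtain ⟨C, hC⟩ := hK.exists_bound_of_continuousOn hf.continuousOn
    exact Integrable.of_bound hf.aestronglyMeasurable C (hKae.mono fun a ha => hC a ha)
  have hgx : ∀ x, Continuous (g x) := fun x => hgc.comp (by fun_prop : Continuous fun y => (x, y))
  have hGx : ∀ x, Continuous (G x) := fun x => hGc.comp (by fun_prop : Continuous fun y => (x, y))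
  obtain ⟨C, hC⟩ := ((isCompact_closedBall x 1).prod hK).exists_bound_of_continuousOn
    hGc.continuousOn
  have hpd : HasFDerivAt p (∫ a, innerSL ℝ (G x a) ∂μ) x := by
    have : p = fun x => ∫ a, g x a ∂μ := funext hp
    rw [this]
    refine hasFDerivAt_integral_of_dominated_of_fderiv_le (bound := fun _ => C)
      (F' := fun x a => innerSL ℝ (G x a))
      (Metric.closedBall_mem_nhds x one_pos) ?_ (hintR _ (hgx x)) ?_ ?_ (integrable_const C) ?_
    · exact Filter.Eventually.of_forall fun z => (hgx z).aestronglyMeasurable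
    · exact ((innerSL ℝ).continuous.comp (hGx x)).aestronglyMeasurable
    · filter_upwards [hKae] with a ha z hz
      rw [innerSL_apply_norm]
      exact hC (z, a) ⟨hz, ha⟩
    · exact Filter.Eventually.of_forall fun a z _ => hgd z a
  have hcomm : ∫ a, innerSL ℝ (G x a) ∂μ = innerSL ℝ (∫ a, G x a ∂μ) :=
    (innerSL ℝ (E := EuclideanSpace ℝ (Fin d))).integral_comp_comm (hint _ (hGx x))
  rw [hcomm] at hpd
  have hgv : ∀ a, g x a • v x a = (αdot / α) • (g x a • x) + (b * β ^ 2 / α) • G x a := by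
    intro a
    simp only [G, hv, hb]
    match_scalars <;> field_simp <;> ring
  have hpu : p x • u x = (αdot / α) • (p x • x) + (b * β ^ 2 / α) • ∫ a, G x a ∂μ := by
    rw [hu, smul_inv_smul₀ (hppos x).ne']
    simp only [hgv]
    have i1 : Integrable (fun a => (αdot / α) • (g x a • x)) μ :=
      hint _ (by have := hgx x; fun_prop)
    have i2 : Integrable (fun a => (b * β ^ 2 / α) • G x a) μ :=
      hint _ (by have := hGx x; fun_prop)
    rw [integral_add i1 i2, integral_smul, integral_smul, integral_smul_const, ← hp]
  have hlog : (fun x => Real.log (g x y / p x)) = fun x => Real.log (g x y) - Real.log (p x) := by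
    funext z
    exact Real.log_div (hgpos z y).ne' (hppos z).ne'
  have hfin := ((hgd x y).log (hgpos x y).ne').sub (hpd.log (hppos x).ne')
  have hI : ∫ a, G x a ∂μ = (α / (b * β ^ 2)) • (p x • u x - (αdot / α) • (p x • x)) := by
    rw [hpu, add_sub_cancel_left, smul_smul]
    have : α / (b * β ^ 2) * (b * β ^ 2 / α) = 1 := by field_simp
    rw [this, one_smul]
  have hgrad : HasGradientAt (fun x => Real.log (g x y / p x))
      ((g x y)⁻¹ • G x y - (p x)⁻¹ • ∫ a, G x a ∂μ) x := by
    rw [hasGradientAt_iff_hasFDerivAt, hlog]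
    refine hfin.congr_fderiv ?_
    ext z
    simp [inner_sub_left, inner_smul_left]
  rw [hgrad.gradient, hI]
  have hpx := (hppos x).ne'
  have hgx' := (hgpos x y).ne'
  have hw : (g x y)⁻¹ • G x y = (α / (b * β ^ 2)) • (v x y - (αdot / α) • x) := by
    have := hgv y
    have h5 : v x y = (αdot / α) • x + (b * β ^ 2 / α) • ((g x y)⁻¹ • G x y) := by
      rw [← inv_smul_smul₀ hgx' (v x y), this]
      match_scalars <;> field_simp
    rw [h5, add_sub_cancel_left, smul_smul (α / (b * β ^ 2)) (b * β ^ 2 / α)]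
    have : α / (b * β ^ 2) * (b * β ^ 2 / α) = 1 := by field_simp
    rw [this, one_smul]
  rw [hw]
  match_scalars <;> field_simp <;> ring
end

section
/- The marginal velocity u is differentiable on ℝ^d, and its Fréchet derivative at any x ∈ ℝ^d decomposes as follows: for every direction z ∈ ℝ^d, (Du(x)) z = (β̇/β)·z + (1/p(x)) · ∫ ⟨∇ₓ log(g(x, y)/p(x)), z⟩ · v(x, y) · g(x, y) dμ(y), where ∇ₓ log(g(x, y)/p(x)) denotes the gradient in x of the log posterior density of y given x. -/
open MeasureTheory RealInnerProductSpace

theorem hasFDerivAt_integral_compact_aux {E G : Type*} [NormedAddCommGroup E] [NormedSpace ℝ E]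
    [FiniteDimensional ℝ E] [MeasurableSpace E] [BorelSpace E]
    [NormedAddCommGroup G] [NormedSpace ℝ G]
    (μ : Measure E) [IsProbabilityMeasure μ] (K : Set E) (hK : IsCompact K) (hμK : μ Kᶜ = 0)
    (F : E → E → G) (F' : E → E → (E →L[ℝ] G))
    (hF : Continuous (fun q : E × E => F q.1 q.2))
    (hF' : Continuous (fun q : E × E => F' q.1 q.2))
    (hd : ∀ x y, HasFDerivAt (fun x => F x y) (F' x y) x) (x : E) :
    Integrable (F x) μ ∧ Integrable (F' x) μ ∧
      HasFDerivAt (fun x => ∫ y, F x y ∂μ) (∫ y, F' x y ∂μ) x := by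
  haveI : ProperSpace E := FiniteDimensional.proper ℝ E
  haveI : SecondCountableTopology E := inferInstance
  have hKae : ∀ᵐ y ∂μ, y ∈ K := hμK
  have hc : IsCompact (Metric.closedBall x 1 ×ˢ K) := (isCompact_closedBall x 1).prod hK
  obtain ⟨C, hC⟩ := hc.exists_bound_of_continuousOn hF.continuousOn
  obtain ⟨C', hC'⟩ := hc.exists_bound_of_continuousOn hF'.continuousOn
  have hx1 : x ∈ Metric.closedBall x 1 := Metric.mem_closedBall_self zero_le_one
  have cF : ∀ x, Continuous (F x) := fun x => hF.comp (Continuous.prodMk_right x)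
  have cF' : ∀ x, Continuous (F' x) := fun x => hF'.comp (Continuous.prodMk_right x)
  have hi : Integrable (F x) μ := by
    refine Integrable.of_bound (cF x).aestronglyMeasurable C ?_
    filter_upwards [hKae] with y hy using hC (x, y) ⟨hx1, hy⟩
  have hi' : Integrable (F' x) μ := by
    refine Integrable.of_bound (cF' x).aestronglyMeasurable C' ?_
    filter_upwards [hKae] with y hy using hC' (x, y) ⟨hx1, hy⟩
  refine ⟨hi, hi', ?_⟩
  refine hasFDerivAt_integral_of_dominated_of_fderiv_le (bound := fun _ => C')
    (s := Metric.closedBall x 1)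
    (Metric.closedBall_mem_nhds x one_pos)
    (Filter.Eventually.of_forall fun x => (cF x).aestronglyMeasurable) hi
    (cF' x).aestronglyMeasurable ?_ (integrable_const _) ?_
  · filter_upwards [hKae] with y hy x' hx' using hC' (x', y) ⟨hx', hy⟩
  · exact Filter.Eventually.of_forall fun y x' _ => hd x' y

/-- The marginal velocity `u` is differentiable on ℝ^d, and its Fréchet
derivative at any `x` decomposes: for every direction `z`,
`(Du x) z = (β̇/β)•z + (1/p x) • ∫ ⟪∇ₓ log (g x y / p x), z⟫ · (v x y) · g x y dμ(y)`. -/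
theorem stmt_7
    (d : ℕ) (hd : 1 ≤ d)
    (α β αdot βdot : ℝ) (hα : 0 < α) (hβ : 0 < β)
    (μ : Measure (EuclideanSpace ℝ (Fin d))) [IsProbabilityMeasure μ]
    (K : Set (EuclideanSpace ℝ (Fin d))) (hK : IsCompact K) (hμK : μ Kᶜ = 0)
    (g : EuclideanSpace ℝ (Fin d) → EuclideanSpace ℝ (Fin d) → ℝ)
    (hg : ∀ x y, g x y =
      (2 * Real.pi * β ^ 2) ^ (-(d : ℝ) / 2) * Real.exp (-‖x - α • y‖ ^ 2 / (2 * β ^ 2)))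
    (p : EuclideanSpace ℝ (Fin d) → ℝ)
    (hp : ∀ x, p x = ∫ y, g x y ∂μ)
    (hppos : ∀ x, 0 < p x)
    (v : EuclideanSpace ℝ (Fin d) → EuclideanSpace ℝ (Fin d) → EuclideanSpace ℝ (Fin d))
    (hv : ∀ x y, v x y = αdot • y + (βdot / β) • (x - α • y))
    (u : EuclideanSpace ℝ (Fin d) → EuclideanSpace ℝ (Fin d))
    (hu : ∀ x, u x = (p x)⁻¹ • ∫ y, g x y • v x y ∂μ) :
    Differentiable ℝ u ∧
      ∀ x z, fderiv ℝ u x z = (βdot / β) • z +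
        (p x)⁻¹ • ∫ y,
          (⟪gradient (fun x => Real.log (g x y / p x)) x, z⟫ * g x y) • v x y ∂μ := by
  set c : ℝ := (2 * Real.pi * β ^ 2) ^ (-(d : ℝ) / 2) with hc
  have hcpos : 0 < c := by positivity
  have hgpos : ∀ x y, 0 < g x y := fun x y => by rw [hg]; positivity
  have hgc : Continuous (fun q : EuclideanSpace ℝ (Fin d) × EuclideanSpace ℝ (Fin d) =>
      g q.1 q.2) := by
    simp only [hg]; fun_prop
  have hvc : Continuous (fun q : EuclideanSpace ℝ (Fin d) × EuclideanSpace ℝ (Fin d) =>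
      v q.1 q.2) := by
    simp only [hv]; fun_prop
  let g' : EuclideanSpace ℝ (Fin d) → EuclideanSpace ℝ (Fin d) →
      (EuclideanSpace ℝ (Fin d) →L[ℝ] ℝ) :=
    fun x y => g x y • ((-(1 / β ^ 2)) • innerSL ℝ (x - α • y))
  have hg'c : Continuous (fun q : EuclideanSpace ℝ (Fin d) × EuclideanSpace ℝ (Fin d) =>
      g' q.1 q.2) := by
    have h0 : Continuous (fun q : EuclideanSpace ℝ (Fin d) × EuclideanSpace ℝ (Fin d) =>
        innerSL ℝ (q.1 - α • q.2)) := (innerSL ℝ).continuous.comp (by fun_prop)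
    have h1 : Continuous (fun q : EuclideanSpace ℝ (Fin d) × EuclideanSpace ℝ (Fin d) =>
        (-(1 / β ^ 2)) • innerSL ℝ (q.1 - α • q.2)) := h0.const_smul (-(1 / β ^ 2))
    exact hgc.smul h1
  have hgd : ∀ x y, HasFDerivAt (fun x => g x y) (g' x y) x := by
    intro x y
    have h1 : HasFDerivAt (fun x : EuclideanSpace ℝ (Fin d) => x - α • y)
        (ContinuousLinearMap.id ℝ _) x := (hasFDerivAt_id x).sub_const _
    have h2 := ((h1.norm_sq.neg.mul_const ((2 * β ^ 2)⁻¹)).exp).const_mul c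
    have e : (fun x => g x y) = fun x => c * Real.exp (-‖x - α • y‖ ^ 2 * (2 * β ^ 2)⁻¹) := by
      funext x; rw [hg, div_eq_mul_inv]
    rw [e]
    refine h2.congr_fderiv ?_
    ext z
    simp only [g', hg, ← hc]
    simp [div_eq_mul_inv]
    ring
  let N' : EuclideanSpace ℝ (Fin d) → EuclideanSpace ℝ (Fin d) →
      (EuclideanSpace ℝ (Fin d) →L[ℝ] EuclideanSpace ℝ (Fin d)) :=
    fun x y => g x y • ((βdot / β) • ContinuousLinearMap.id ℝ (EuclideanSpace ℝ (Fin d)))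
      + (g' x y).smulRight (v x y)
  have hvd : ∀ x y, HasFDerivAt (fun x => v x y)
      ((βdot / β) • ContinuousLinearMap.id ℝ (EuclideanSpace ℝ (Fin d))) x := by
    intro x y
    simp only [hv]
    exact (((hasFDerivAt_id x).sub_const _).const_smul (βdot / β)).const_add _
  have hNd : ∀ x y, HasFDerivAt (fun x => g x y • v x y) (N' x y) x :=
    fun x y => (hgd x y).smul (hvd x y)
  have hN'c : Continuous (fun q : EuclideanSpace ℝ (Fin d) × EuclideanSpace ℝ (Fin d) =>
      N' q.1 q.2) := by
    refine (hgc.smul continuous_const).add ?_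
    exact ((ContinuousLinearMap.smulRightL ℝ (EuclideanSpace ℝ (Fin d))
      (EuclideanSpace ℝ (Fin d))).continuous.comp hg'c).clm_apply hvc
  have A := hasFDerivAt_integral_compact_aux μ K hK hμK g g' hgc hg'c hgd
  have B := hasFDerivAt_integral_compact_aux μ K hK hμK (fun x y => g x y • v x y) N'
    (hgc.smul hvc) hN'c hNd
  have hpd : ∀ x, HasFDerivAt p (∫ y, g' x y ∂μ) x := by
    intro x
    have : p = fun x => ∫ y, g x y ∂μ := funext hp
    rw [this]; exact (A x).2.2
  have hud : ∀ x, HasFDerivAt u ((p x)⁻¹ • (∫ y, N' x y ∂μ) +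
      ((-(p x ^ 2)⁻¹) • (∫ y, g' x y ∂μ)).smulRight (∫ y, g x y • v x y ∂μ)) x := by
    intro x
    have : u = fun x => (p x)⁻¹ • ∫ y, g x y • v x y ∂μ := funext hu
    rw [this]
    have hi : HasFDerivAt (fun x => (p x)⁻¹) ((-(p x ^ 2)⁻¹) • (∫ y, g' x y ∂μ)) x :=
      (hasDerivAt_inv (hppos x).ne').comp_hasFDerivAt x (hpd x)
    exact hi.smul (B x).2.2
  refine ⟨fun x => (hud x).differentiableAt, fun x z => ?_⟩
  rw [(hud x).fderiv]
  obtain ⟨Ai, Ai', -⟩ := A x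
  obtain ⟨Bi, Bi', -⟩ := B x
  have hgrad : ∀ y, ⟪gradient (fun x => Real.log (g x y / p x)) x, z⟫ * g x y
      = g' x y z - ((p x)⁻¹ * (∫ y, g' x y ∂μ) z) * g x y := by
    intro y
    have e : (fun x => Real.log (g x y / p x)) = fun x => Real.log (g x y) - Real.log (p x) := by
      funext x; exact Real.log_div (hgpos x y).ne' (hppos x).ne'
    have hl := ((hgd x y).log (hgpos x y).ne').sub ((hpd x).log (hppos x).ne')
    have : ⟪gradient (fun x => Real.log (g x y / p x)) x, z⟫
        = fderiv ℝ (fun x => Real.log (g x y / p x)) x z := by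
      simp [gradient]
    rw [this, e]
    erw [hl.fderiv]
    have := (hgpos x y).ne'
    simp only [ContinuousLinearMap.sub_apply, ContinuousLinearMap.smul_apply, smul_eq_mul]
    field_simp
  have hgv : Integrable (fun y => g' x y z • v x y) μ := by
    have h1 := (Bi'.apply_continuousLinearMap z).sub (Ai.smul_const ((βdot / β) • z))
    refine h1.congr (Filter.Eventually.of_forall fun y => ?_)
    simp [N']
  have hN'z : (∫ y, N' x y ∂μ) z = p x • ((βdot / β) • z) + ∫ y, g' x y z • v x y ∂μ := by
    rw [ContinuousLinearMap.integral_apply Bi', hp x, ← integral_smul_const,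
      ← integral_add (Ai.smul_const _) hgv]
    rfl
  have hR : ∫ y, (⟪gradient (fun x => Real.log (g x y / p x)) x, z⟫ * g x y) • v x y ∂μ
      = (∫ y, g' x y z • v x y ∂μ)
        - ((p x)⁻¹ * (∫ y, g' x y ∂μ) z) • ∫ y, g x y • v x y ∂μ := by
    have hB2 : Integrable (fun y => ((p x)⁻¹ * (∫ y, g' x y ∂μ) z) • g x y • v x y) μ :=
      Bi.smul ((p x)⁻¹ * (∫ y, g' x y ∂μ) z)
    rw [← integral_smul, ← integral_sub hgv hB2]
    congr 1
    funext y
    rw [hgrad, sub_smul, mul_smul]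
  rw [hR]
  simp only [ContinuousLinearMap.add_apply, ContinuousLinearMap.smul_apply,
    ContinuousLinearMap.smulRight_apply, hN'z, smul_add, smul_sub, smul_eq_mul]
  rw [inv_smul_smul₀ (hppos x).ne', smul_smul (p x)⁻¹ ((p x)⁻¹ * _), add_assoc, sub_eq_add_neg,
    ← neg_smul]
  congr 3
  rw [← mul_assoc, pow_two, mul_inv, neg_mul]
end

section
/- The posterior mean m is differentiable on ℝ^d, and its Fréchet derivative at any x ∈ ℝ^d equals α/β² times the posterior covariance of y given x: for every direction z ∈ ℝ^d, (Dm(x)) z = (α/β²) · (1/p(x)) · ∫ ⟨y − m(x), z⟩ · (y − m(x)) · g(x, y) dμ(y). -/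
open MeasureTheory RealInnerProductSpace

lemma aux_int {Y V : Type*} [NormedAddCommGroup Y] [MeasurableSpace Y]
    [BorelSpace Y] [NormedAddCommGroup V] [SecondCountableTopology Y] (μ : Measure Y)
    [IsFiniteMeasure μ] (K : Set Y) (hK : IsCompact K) (hμK : μ Kᶜ = 0)
    (f : Y → V) (hf : Continuous f) : Integrable f μ := by
  have h : μ.restrict K = μ := Measure.restrict_eq_self_of_ae_mem (by
    rw [ae_iff]; exact hμK)
  rw [← h]
  exact hf.continuousOn.integrableOn_compact hK

lemma aux_diff {Y V : Type*} [NormedAddCommGroup Y] [NormedSpace ℝ Y] [ProperSpace Y]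
    [MeasurableSpace Y]
    [BorelSpace Y] [NormedAddCommGroup V] [NormedSpace ℝ V]
    [SecondCountableTopology Y] (μ : Measure Y)
    [IsFiniteMeasure μ] (K : Set Y) (hK : IsCompact K) (hμK : μ Kᶜ = 0)
    (F : Y → Y → V) (F' : Y → Y → Y →L[ℝ] V)
    (hF : ∀ x, Continuous (F x))
    (hF' : Continuous (fun q : Y × Y => F' q.1 q.2))
    (hd : ∀ x y, HasFDerivAt (F · y) (F' x y) x) (x : Y) :
    HasFDerivAt (fun x => ∫ y, F x y ∂μ) (∫ y, F' x y ∂μ) x := by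
  obtain ⟨C, hC⟩ := ((isCompact_closedBall x (1:ℝ)).prod hK).exists_bound_of_continuousOn
    hF'.continuousOn
  have hFi := fun x => aux_int μ K hK hμK (F x) (hF x)
  have hFi' := aux_int μ K hK hμK (F' x) (hF'.comp (by fun_prop : Continuous fun y => (x, y)))
  refine hasFDerivAt_integral_of_dominated_of_fderiv_le (bound := fun _ => C)
    (Metric.closedBall_mem_nhds x one_pos) (Filter.Eventually.of_forall fun x => (hFi x).1)
    (hFi x) hFi'.1 ?_ (integrable_const C) (Filter.Eventually.of_forall fun y x _ => hd x y)
  have : ∀ᵐ y ∂μ, y ∈ K := by rw [ae_iff]; exact hμK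
  filter_upwards [this] with y hy z hz
  exact hC (z, y) ⟨hz, hy⟩

set_option maxHeartbeats 1000000

/-- The posterior mean `m` is differentiable on ℝ^d, and its Fréchet
derivative at any `x` equals `α/β²` times the posterior covariance of `y` given `x`:
for every direction `z`,
`(Dm x) z = (α/β²) • ((1/p x) • ∫ ⟪y − m x, z⟫ · (y − m x) · g x y dμ(y))`. -/
theorem stmt_8
    (d : ℕ) (hd : 1 ≤ d)
    (α β : ℝ) (hα : 0 < α) (hβ : 0 < β)
    (μ : Measure (EuclideanSpace ℝ (Fin d))) [IsProbabilityMeasure μ]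
    (K : Set (EuclideanSpace ℝ (Fin d))) (hK : IsCompact K) (hμK : μ Kᶜ = 0)
    (g : EuclideanSpace ℝ (Fin d) → EuclideanSpace ℝ (Fin d) → ℝ)
    (hg : ∀ x y, g x y =
      (2 * Real.pi * β ^ 2) ^ (-(d : ℝ) / 2) * Real.exp (-‖x - α • y‖ ^ 2 / (2 * β ^ 2)))
    (p : EuclideanSpace ℝ (Fin d) → ℝ)
    (hp : ∀ x, p x = ∫ y, g x y ∂μ)
    (hppos : ∀ x, 0 < p x)
    (m : EuclideanSpace ℝ (Fin d) → EuclideanSpace ℝ (Fin d))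
    (hm : ∀ x, m x = (p x)⁻¹ • ∫ y, g x y • y ∂μ) :
    Differentiable ℝ m ∧
      ∀ x z, fderiv ℝ m x z =
        (α / β ^ 2) • ((p x)⁻¹ • ∫ y, (⟪y - m x, z⟫ * g x y) • (y - m x) ∂μ) := by
  have hβ0 : β ≠ 0 := hβ.ne'
  generalize (2 * Real.pi * β ^ 2) ^ (-(d : ℝ) / 2) = c at hg
  have hgdef : g = fun x y => c * Real.exp (-‖x - α • y‖ ^ 2 / (2 * β ^ 2)) := by
    funext x y; exact hg x y
  have hgc : Continuous (fun q : EuclideanSpace ℝ (Fin d) × EuclideanSpace ℝ (Fin d) =>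
      g q.1 q.2) := by
    simp only [hgdef]; fun_prop
  have hgc1 : ∀ x, Continuous (g x) := fun x => by
    simp only [hgdef]; fun_prop
  obtain ⟨G', hG'⟩ : ∃ G' : EuclideanSpace ℝ (Fin d) → EuclideanSpace ℝ (Fin d) →
      EuclideanSpace ℝ (Fin d) →L[ℝ] ℝ, G' =
    fun x y => (-(g x y) / β ^ 2) • innerSL ℝ (x - α • y) := ⟨_, rfl⟩
  have hGc : Continuous (fun q : EuclideanSpace ℝ (Fin d) × EuclideanSpace ℝ (Fin d) =>
      G' q.1 q.2) := by
    simp only [hG']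
    have := (innerSL ℝ (E := EuclideanSpace ℝ (Fin d))).continuous
    fun_prop
  have hgd : ∀ x y, HasFDerivAt (g · y) (G' x y) x := by
    intro x y
    have h1 : HasFDerivAt (fun x : EuclideanSpace ℝ (Fin d) => x - α • y)
      (ContinuousLinearMap.id ℝ _) x := (hasFDerivAt_id x).sub_const _
    have h2 := (((h1.norm_sq.neg.mul_const (2 * β ^ 2)⁻¹)).exp).const_mul c
    simp only [← div_eq_mul_inv, Pi.neg_apply] at h2
    rw [show (fun x => g x y) = fun x => c * Real.exp (-‖x - α • y‖ ^ 2 / (2 * β ^ 2)) from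
      funext fun x => hg x y]
    refine h2.congr_fderiv ?_
    ext z
    simp [hG', hgdef]
    field_simp
  have hpd : ∀ x, HasFDerivAt p (∫ y, G' x y ∂μ) x := fun x => by
    rw [funext hp]
    exact aux_diff μ K hK hμK g G' hgc1 hGc hgd x
  have hNc : Continuous (fun q : EuclideanSpace ℝ (Fin d) × EuclideanSpace ℝ (Fin d) =>
      (G' q.1 q.2).smulRight q.2) := by
    have := (ContinuousLinearMap.smulRightL ℝ (EuclideanSpace ℝ (Fin d))
      (EuclideanSpace ℝ (Fin d))).continuous
    exact (this.comp hGc).clm_apply continuous_snd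
  have hNd : ∀ x, HasFDerivAt (fun x => ∫ y, g x y • y ∂μ)
      (∫ y, (G' x y).smulRight y ∂μ) x := fun x => by
    refine aux_diff μ K hK hμK (fun x y => g x y • y) (fun x y => (G' x y).smulRight y)
      (fun x => (hgc1 x).smul continuous_id) hNc (fun x y => (hgd x y).smul_const y) x
  have hmd : ∀ x, HasFDerivAt m ((p x)⁻¹ • (∫ y, (G' x y).smulRight y ∂μ) +
      ((-(p x ^ 2)⁻¹) • (∫ y, G' x y ∂μ)).smulRight (∫ y, g x y • y ∂μ)) x := fun x => by
    rw [funext hm]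
    exact ((hasDerivAt_inv (hppos x).ne').comp_hasFDerivAt x (hpd x)).smul (hNd x)
  refine ⟨fun x => (hmd x).differentiableAt, fun x z => ?_⟩
  have hxc : Continuous fun y : EuclideanSpace ℝ (Fin d) => (x, y) := by fun_prop
  have I : ∀ {f : EuclideanSpace ℝ (Fin d) → EuclideanSpace ℝ (Fin d)}, Continuous f →
    Integrable f μ := fun hf => aux_int μ K hK hμK _ hf
  have hIG : Integrable (G' x) μ := aux_int μ K hK hμK _ (hGc.comp hxc)
  have hIN : Integrable (fun y => (G' x y).smulRight y) μ :=
    aux_int μ K hK hμK _ (hNc.comp hxc)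
  have hgi : Integrable (g x) μ := aux_int μ K hK hμK _ (hgc1 x)
  have hg1 := hgc1 x
  have hp0 := (hppos x).ne'
  have hN : ∫ y, g x y • y ∂μ = p x • m x := by
    rw [hm x, smul_smul, mul_inv_cancel₀ hp0, one_smul]
  have hzero : ∫ y, g x y • (y - m x) ∂μ = 0 := by
    simp only [smul_sub]
    rw [integral_sub (I (by fun_prop)) (I (by fun_prop)), hN, integral_smul_const, ← hp x,
      sub_self]
  have hG'i : Integrable (fun y => G' x y z) μ := hIG.apply_continuousLinearMap z
  have key : (∫ y, G' x y z • y ∂μ) - (∫ y, G' x y z ∂μ) • m x =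
      (α / β ^ 2) • ∫ y, (⟪y - m x, z⟫ * g x y) • (y - m x) ∂μ := by
    have e1 : Continuous fun y => G' x y z := (hGc.comp hxc).clm_apply continuous_const
    rw [← integral_smul_const, ← integral_sub (I (by fun_prop)) (I (by fun_prop)),
      ← integral_smul]
    have e2 : ∀ y, G' x y z • y - G' x y z • m x =
        (α / β ^ 2) • (⟪y - m x, z⟫ * g x y) • (y - m x) +
        (-⟪x - α • m x, z⟫ / β ^ 2) • (g x y • (y - m x)) := by
      intro y
      rw [← smul_sub, smul_smul, smul_smul, ← add_smul]
      congr 1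
      simp only [hG', smul_apply, innerSL_apply_apply, inner_sub_left,
        real_inner_smul_left, smul_eq_mul]
      field_simp
      ring
    simp only [e2]
    rw [integral_add (I (by fun_prop)) (I (by fun_prop)), integral_smul _ (fun y => g x y • (y - m x)), hzero, smul_zero, add_zero]
  rw [(hmd x).fderiv, smul_comm, ← key]
  have a1 : (∫ y, G' x y ∂μ) z = ∫ y, G' x y z ∂μ := ContinuousLinearMap.integral_apply hIG z
  have a2 : (∫ y, (G' x y).smulRight y ∂μ) z = ∫ y, G' x y z • y ∂μ :=
    ContinuousLinearMap.integral_apply hIN z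
  simp only [add_apply, smul_apply,
    ContinuousLinearMap.smulRight_apply, a1, a2, hN, smul_sub, smul_smul, smul_eq_mul]
  rw [sub_eq_add_neg, ← neg_smul]
  congr 2
  field_simp
end
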